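/- Let 0 < η₁ < α₁, m = η₁/α₁, c₁ = −α₁² + α₁²·E(m)/K(m), and c₂ = (1/3)α₁²η₁² + (1/6)(α₁² + η₁²)c₁. Then ∫_{−η₁}^{η₁} (ζ⁴ − (1/2)(α₁² + η₁²)ζ² + c₂)/√((η₁² − ζ²)(α₁² − ζ²)) dζ = 0. -/

import Mathlib

open Real

/-- The complete elliptic integral of the first kind,
`K(m) = ∫₀^{π/2} dθ/√(1 − m² sin²θ)`. -/
noncomputable def ellipticK (m : ℝ) : ℝ :=
  ∫ θ in (0:ℝ)..(π / 2), 1 / Real.sqrt (1 - m ^ 2 * Real.sin θ ^ 2)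

/-- The complete elliptic integral of the second kind,
`E(m) = ∫₀^{π/2} √(1 − m² sin²θ) dθ`. -/
noncomputable def ellipticE (m : ℝ) : ℝ :=
  ∫ θ in (0:ℝ)..(π / 2), Real.sqrt (1 - m ^ 2 * Real.sin θ ^ 2)

theorem one_sub_sq_mul_sin_sq_pos {m : ℝ} (h₀ : 0 ≤ m) (h₁ : m < 1) (θ : ℝ) :
    0 < 1 - m ^ 2 * Real.sin θ ^ 2 := by
  nlinarith [Real.sin_sq_le_one θ, sq_nonneg (Real.sin θ), sq_nonneg m]

theorem continuous_sqrt_one_sub_sq_mul_sin_sq (m : ℝ) :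
    Continuous fun θ : ℝ => Real.sqrt (1 - m ^ 2 * Real.sin θ ^ 2) := by
  fun_prop

theorem continuous_one_div_sqrt_one_sub_sq_mul_sin_sq {m : ℝ} (h₀ : 0 ≤ m) (h₁ : m < 1) :
    Continuous fun θ : ℝ => 1 / Real.sqrt (1 - m ^ 2 * Real.sin θ ^ 2) :=
  continuous_const.div (continuous_sqrt_one_sub_sq_mul_sin_sq m)
    fun θ => (Real.sqrt_pos.2 (one_sub_sq_mul_sin_sq_pos h₀ h₁ θ)).ne'

theorem ellipticK_pos {m : ℝ} (h₀ : 0 ≤ m) (h₁ : m < 1) : 0 < ellipticK m := by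
  refine intervalIntegral.intervalIntegral_pos_of_pos
    ((continuous_one_div_sqrt_one_sub_sq_mul_sin_sq h₀ h₁).intervalIntegrable _ _)
    (fun θ => ?_) (by positivity)
  exact one_div_pos.2 (Real.sqrt_pos.2 (one_sub_sq_mul_sin_sq_pos h₀ h₁ θ))

theorem intervalIntegral_symm_of_even {f : ℝ → ℝ} (hf : Continuous f) (heven : ∀ x, f (-x) = f x)
    (a : ℝ) : ∫ x in (-a)..a, f x = 2 * ∫ x in (0 : ℝ)..a, f x := by
  have h : ∫ x in (-a)..0, f x = ∫ x in (0 : ℝ)..a, f x := by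
    simpa [heven] using (intervalIntegral.integral_comp_neg f (a := 0) (b := a)).symm
  rw [← intervalIntegral.integral_add_adjacent_intervals
    (hf.intervalIntegrable (-a) 0) (hf.intervalIntegrable 0 a), h, two_mul]

theorem integral_one_div_sqrt_eq_two_mul_ellipticK {m : ℝ} (h₀ : 0 ≤ m) (h₁ : m < 1) :
    ∫ θ in (-(π / 2))..(π / 2), 1 / Real.sqrt (1 - m ^ 2 * Real.sin θ ^ 2)
      = 2 * ellipticK m :=
  intervalIntegral_symm_of_even (continuous_one_div_sqrt_one_sub_sq_mul_sin_sq h₀ h₁)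
    (by simp) _

theorem integral_sqrt_eq_two_mul_ellipticE (m : ℝ) :
    ∫ θ in (-(π / 2))..(π / 2), Real.sqrt (1 - m ^ 2 * Real.sin θ ^ 2) = 2 * ellipticE m :=
  intervalIntegral_symm_of_even (continuous_sqrt_one_sub_sq_mul_sin_sq m) (by simp) _

theorem image_mul_sin_Ioo {r : ℝ} (hr : 0 < r) :
    (fun θ => r * Real.sin θ) '' Set.Ioo (-(π / 2)) (π / 2) = Set.Ioo (-r) r := by
  ext x
  constructor
  · rintro ⟨θ, hθ, rfl⟩
    have hc := Real.cos_pos_of_mem_Ioo hθ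
    have hs := Real.sin_sq_add_cos_sq θ
    have hlt : Real.sin θ < 1 := by nlinarith
    have hgt : -1 < Real.sin θ := by nlinarith
    constructor <;> dsimp only <;> nlinarith
  · rintro ⟨hl, hu⟩
    have hl' : -1 < x / r := by rw [lt_div_iff₀ hr]; linarith
    have hu' : x / r < 1 := by rw [div_lt_one hr]; exact hu
    refine ⟨Real.arcsin (x / r), ⟨Real.neg_pi_div_two_lt_arcsin.2 hl',
      Real.arcsin_lt_pi_div_two.2 hu'⟩, ?_⟩
    dsimp only
    rw [Real.sin_arcsin hl'.le hu'.le]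
    field_simp

/-- The substitution `x = r sin θ`, which requires no regularity of the integrand. -/
theorem integral_eq_integral_comp_mul_sin {r : ℝ} (hr : 0 < r) (f : ℝ → ℝ) :
    ∫ x in (-r)..r, f x
      = ∫ θ in Set.Ioo (-(π / 2)) (π / 2), r * Real.cos θ * f (r * Real.sin θ) := by
  rw [intervalIntegral.integral_of_le (by linarith), MeasureTheory.integral_Ioc_eq_integral_Ioo,
    ← image_mul_sin_Ioo hr,
    MeasureTheory.integral_image_eq_integral_abs_deriv_smul measurableSet_Ioo
      (fun θ _ => ((Real.hasDerivAt_sin θ).const_mul r).hasDerivWithinAt)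
      (fun x hx y hy hxy => Real.injOn_sin (Set.Ioo_subset_Icc_self hx)
        (Set.Ioo_subset_Icc_self hy) (mul_left_cancel₀ hr.ne' hxy))]
  refine MeasureTheory.setIntegral_congr_fun measurableSet_Ioo fun θ hθ => ?_
  have := Real.cos_pos_of_mem_Ioo hθ
  simp only [smul_eq_mul]
  rw [abs_of_pos (by positivity)]

theorem hasDerivAt_sin_mul_cos_mul_sqrt {m : ℝ} (h₀ : 0 ≤ m) (h₁ : m < 1) (θ : ℝ) :
    HasDerivAt
      (fun θ => Real.sin θ * Real.cos θ * Real.sqrt (1 - m ^ 2 * Real.sin θ ^ 2))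
      ((1 - 2 * (1 + m ^ 2) * Real.sin θ ^ 2 + 3 * m ^ 2 * Real.sin θ ^ 4)
        * (1 / Real.sqrt (1 - m ^ 2 * Real.sin θ ^ 2))) θ := by
  have hpos := one_sub_sq_mul_sin_sq_pos h₀ h₁ θ
  have hsqrt := Real.sqrt_pos.2 hpos
  have hd := ((Real.hasDerivAt_sin θ).mul (Real.hasDerivAt_cos θ)).mul
    (((((Real.hasDerivAt_sin θ).pow 2).const_mul (m ^ 2)).const_sub 1).sqrt hpos.ne')
  refine hd.congr_deriv ?_
  simp only [Pi.mul_apply, Pi.pow_apply]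
  have hs := Real.sq_sqrt hpos.le
  have hc := Real.cos_sq' θ
  generalize Real.sqrt (1 - m ^ 2 * Real.sin θ ^ 2) = D at *
  field_simp
  push_cast
  rw [hs]
  simp only [hc]
  ring

theorem integral_deriv_sin_mul_cos_mul_sqrt {m : ℝ} (h₀ : 0 ≤ m) (h₁ : m < 1) :
    ∫ θ in (-(π / 2))..(π / 2),
      (1 - 2 * (1 + m ^ 2) * Real.sin θ ^ 2 + 3 * m ^ 2 * Real.sin θ ^ 4)
        * (1 / Real.sqrt (1 - m ^ 2 * Real.sin θ ^ 2)) = 0 := by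
  rw [intervalIntegral.integral_eq_sub_of_hasDerivAt
    (fun θ _ => hasDerivAt_sin_mul_cos_mul_sqrt h₀ h₁ θ)]
  · simp
  · exact (Continuous.mul (by fun_prop)
      (continuous_one_div_sqrt_one_sub_sq_mul_sin_sq h₀ h₁)).intervalIntegrable _ _

/-- Normalization condition for `Q_{α₁,2}(λ) = λ⁴ − (1/2)(α₁² + η₁²)λ² + c₂` with
`c₂ = (1/3)α₁²η₁² + (1/6)(α₁² + η₁²)c₁` and `c₁ = −α₁² + α₁² E(m)/K(m)`, `m = η₁/α₁`:
`∫_{−η₁}^{η₁} Q_{α₁,2}(ζ)/√((η₁² − ζ²)(α₁² − ζ²)) dζ = 0`. -/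
theorem Q2_normalization (η₁ α₁ : ℝ) (h₀ : 0 < η₁) (h₁ : η₁ < α₁) :
    ∫ ζ in (-η₁)..η₁,
        (ζ ^ 4 - (1 / 2) * (α₁ ^ 2 + η₁ ^ 2) * ζ ^ 2
            + ((1 / 3) * α₁ ^ 2 * η₁ ^ 2
              + (1 / 6) * (α₁ ^ 2 + η₁ ^ 2)
                * (-α₁ ^ 2 + α₁ ^ 2 * ellipticE (η₁ / α₁) / ellipticK (η₁ / α₁))))
          / Real.sqrt ((η₁ ^ 2 - ζ ^ 2) * (α₁ ^ 2 - ζ ^ 2)) = 0 := by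
  obtain ⟨m, hm⟩ : ∃ m, m = η₁ / α₁ := ⟨_, rfl⟩
  have hα : 0 < α₁ := h₀.trans h₁
  have hη : η₁ = m * α₁ := by rw [hm]; field_simp
  have hm₀ : 0 ≤ m := by rw [hm]; positivity
  have hm₁ : m < 1 := by rw [hm, div_lt_one hα]; exact h₁
  have hK := ellipticK_pos hm₀ hm₁
  rw [← hm, integral_eq_integral_comp_mul_sin h₀, ← MeasureTheory.integral_Ioc_eq_integral_Ioo,
    ← intervalIntegral.integral_of_le (by linarith [Real.pi_pos])]
  have hcongr : ∀ θ ∈ Set.Ioo (-(π / 2)) (π / 2), η₁ * Real.cos θ *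
        (((η₁ * Real.sin θ) ^ 4 - (1 / 2) * (α₁ ^ 2 + η₁ ^ 2) * (η₁ * Real.sin θ) ^ 2
            + ((1 / 3) * α₁ ^ 2 * η₁ ^ 2
              + (1 / 6) * (α₁ ^ 2 + η₁ ^ 2)
                * (-α₁ ^ 2 + α₁ ^ 2 * ellipticE m / ellipticK m)))
          / Real.sqrt ((η₁ ^ 2 - (η₁ * Real.sin θ) ^ 2) * (α₁ ^ 2 - (η₁ * Real.sin θ) ^ 2)))
      = α₁ * η₁ ^ 2 / 3 *
          ((1 - 2 * (1 + m ^ 2) * Real.sin θ ^ 2 + 3 * m ^ 2 * Real.sin θ ^ 4)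
            * (1 / Real.sqrt (1 - m ^ 2 * Real.sin θ ^ 2)))
        + ((α₁ ^ 2 + η₁ ^ 2) / 6 * α₁ * (ellipticE m / ellipticK m)
            * (1 / Real.sqrt (1 - m ^ 2 * Real.sin θ ^ 2))
          - (α₁ ^ 2 + η₁ ^ 2) / 6 * α₁ * Real.sqrt (1 - m ^ 2 * Real.sin θ ^ 2)) := by
    intro θ hθ
    have hcos := Real.cos_pos_of_mem_Ioo hθ
    have hpos := one_sub_sq_mul_sin_sq_pos hm₀ hm₁ θ
    have hsqrt := Real.sqrt_pos.2 hpos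
    have hs := Real.sq_sqrt hpos.le
    have hR : Real.sqrt ((η₁ ^ 2 - (η₁ * Real.sin θ) ^ 2) * (α₁ ^ 2 - (η₁ * Real.sin θ) ^ 2))
        = η₁ * Real.cos θ * (α₁ * Real.sqrt (1 - m ^ 2 * Real.sin θ ^ 2)) := by
      rw [Real.sqrt_eq_iff_mul_self_eq_of_pos (by positivity)]
      have hc := Real.cos_sq' θ
      calc _ = η₁ ^ 2 * Real.cos θ ^ 2 * α₁ ^ 2
              * Real.sqrt (1 - m ^ 2 * Real.sin θ ^ 2) ^ 2 := by ring
        _ = _ := by rw [hs, hc, hη]; ring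
    rw [hR]
    generalize Real.sqrt (1 - m ^ 2 * Real.sin θ ^ 2) = D at *
    generalize ellipticE m = E at *
    generalize ellipticK m = K at *
    field_simp
    rw [hs, hη]
    ring
  rw [intervalIntegral.integral_congr_Ioo_of_le (by linarith [Real.pi_pos]) hcongr]
  have hcK := continuous_one_div_sqrt_one_sub_sq_mul_sin_sq hm₀ hm₁
  have hcE := continuous_sqrt_one_sub_sq_mul_sin_sq m
  have hcF : Continuous fun θ : ℝ =>
      (1 - 2 * (1 + m ^ 2) * Real.sin θ ^ 2 + 3 * m ^ 2 * Real.sin θ ^ 4)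
        * (1 / Real.sqrt (1 - m ^ 2 * Real.sin θ ^ 2)) := Continuous.mul (by fun_prop) hcK
  simp only [← add_sub_assoc]
  rw [intervalIntegral.integral_sub
      (((hcF.const_mul _).intervalIntegrable _ _).add ((hcK.const_mul _).intervalIntegrable _ _))
      ((hcE.const_mul _).intervalIntegrable _ _),
    intervalIntegral.integral_add ((hcF.const_mul _).intervalIntegrable _ _)
      ((hcK.const_mul _).intervalIntegrable _ _)]
  simp only [intervalIntegral.integral_const_mul]
  rw [integral_deriv_sin_mul_cos_mul_sqrt hm₀ hm₁,
    integral_one_div_sqrt_eq_two_mul_ellipticK hm₀ hm₁, integral_sqrt_eq_two_mul_ellipticE]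
  field_simp
  ring
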